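/- Let (Λ,d) be a finitely aligned k-graph, E ⊆ Λ finite, and {t_λ : λ ∈ Λ} a Cuntz–Krieger Λ-family. Then for every μ ∈ ΠE one has t_μ t_μ* = Σ Q(t)^{ΠE}_{μν}, where the sum is over all ν ∈ s(μ)Λ (including ν = s(μ)) such that μν ∈ ΠE. -/

import Mathlib

open scoped BigOperators

/-- A `k`-graph: a countable small category (in arrows-only presentation, with objects
identified with the identity morphisms) together with a degree functor into `ℕ^k`
satisfying the factorisation property.  `comp l m` is the composite path `lm`
(first `m`, then `l` in categorical order; range `rng l`, source `src m`), and is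
only meaningful when `src l = rng m`. -/
structure KGraph (k : ℕ) where
  Path : Type
  countable : Countable Path
  src : Path → Path
  rng : Path → Path
  comp : Path → Path → Path
  deg : Path → Fin k → ℕ
  deg_src : ∀ l, deg (src l) = 0
  deg_rng : ∀ l, deg (rng l) = 0
  src_eq_of_deg_zero : ∀ v, deg v = 0 → src v = v
  rng_eq_of_deg_zero : ∀ v, deg v = 0 → rng v = v
  comp_src_self : ∀ l, comp l (src l) = l
  rng_comp_self : ∀ l, comp (rng l) l = l
  src_comp : ∀ l m, src l = rng m → src (comp l m) = src m
  rng_comp : ∀ l m, src l = rng m → rng (comp l m) = rng l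
  deg_comp : ∀ l m, src l = rng m → deg (comp l m) = deg l + deg m
  comp_assoc : ∀ l m n, src l = rng m → src m = rng n →
    comp (comp l m) n = comp l (comp m n)
  factorisation : ∀ (l : Path) (m n : Fin k → ℕ), deg l = m + n →
    ∃! p : Path × Path, deg p.1 = m ∧ deg p.2 = n ∧ src p.1 = rng p.2 ∧
      comp p.1 p.2 = l

namespace KGraph

variable {k : ℕ} (Λ : KGraph k)

/-- The vertices of a `k`-graph are the paths of degree `0`. -/
def IsVertex (v : Λ.Path) : Prop := Λ.deg v = 0

/-- An edge is a path of degree `e_i` for some `i`. -/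
def IsEdge (e : Λ.Path) : Prop := ∃ i : Fin k, Λ.deg e = Pi.single i 1

/-- `vΛ`, the set of paths with range `v`. -/
def withRange (v : Λ.Path) : Set Λ.Path := {l | Λ.rng l = v}

/-- `Λ^min(l,m)`, the set of pairs giving minimal common extensions of `l` and `m`. -/
def minExt (l m : Λ.Path) : Set (Λ.Path × Λ.Path) :=
  {p | Λ.src l = Λ.rng p.1 ∧ Λ.src m = Λ.rng p.2 ∧
    Λ.comp l p.1 = Λ.comp m p.2 ∧ Λ.deg (Λ.comp l p.1) = Λ.deg l ⊔ Λ.deg m}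

/-- A `k`-graph is finitely aligned if all the sets `Λ^min(l,m)` are finite. -/
def FinitelyAligned : Prop := ∀ l m, (Λ.minExt l m).Finite

/-- A subset `E ⊆ vΛ` is exhaustive if every path in `vΛ` has a common extension
with some member of `E`. -/
def Exhaustive (v : Λ.Path) (E : Set Λ.Path) : Prop :=
  ∀ m ∈ Λ.withRange v, ∃ l ∈ E, (Λ.minExt l m).Nonempty

/-- `Λ^{≤ n}`. -/
def degLe (n : Fin k → ℕ) : Set Λ.Path :=
  {l | Λ.deg l ≤ n ∧ ∀ i : Fin k, Λ.deg l i < n i →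
    ¬∃ e, Λ.rng e = Λ.src l ∧ Λ.deg e = Pi.single i 1}

end KGraph

open Classical in
/-- The sum of `f` over a set `S`, defined to be `0` if `S` is infinite. -/
noncomputable def setSum {ι A : Type*} [AddCommMonoid A] (S : Set ι) (f : ι → A) : A :=
  if h : S.Finite then ∑ i ∈ h.toFinset, f i else 0

open Classical in
/-- The product of `f` over a set `S` taken in an arbitrary (but fixed) order,
defined to be `1` if `S` is infinite.  All products appearing below have commuting
factors, for which this is the usual product over a finite set. -/
noncomputable def setProd {ι A : Type*} [Monoid A] (S : Set ι) (f : ι → A) : A :=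
  if h : S.Finite then (h.toFinset.toList.map f).prod else 1

namespace KGraph

variable {k : ℕ} (Λ : KGraph k) {A : Type*} [Ring A] [StarRing A]

/-- Relations (CK1)–(CK3) for a family of partial isometries indexed by a `k`-graph. -/
structure IsCK13 (t : Λ.Path → A) : Prop where
  partialIsometry : ∀ l, t l * star (t l) * t l = t l
  vertex_projection : ∀ v, Λ.IsVertex v → star (t v) = t v ∧ t v * t v = t v
  vertex_orthogonal : ∀ v w, Λ.IsVertex v → Λ.IsVertex w → v ≠ w → t v * t w = 0
  comp_mul : ∀ l m, Λ.src l = Λ.rng m → t l * t m = t (Λ.comp l m)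
  ck3 : ∀ l m, star (t l) * t m =
    setSum (Λ.minExt l m) fun p => t p.1 * star (t p.2)

/-- A Cuntz–Krieger `Λ`-family: relations (CK1)–(CK4). -/
structure IsCKFamily (t : Λ.Path → A) extends IsCK13 Λ t : Prop where
  ck4 : ∀ v E, Λ.IsVertex v → E ⊆ Λ.withRange v → E.Finite → Λ.Exhaustive v E →
    setProd E (fun l => t v - t l * star (t l)) = 0

/-- Condition (†) on a subset `F ⊆ Λ`. -/
def DaggerClosed (F : Set Λ.Path) : Prop :=
  ∀ l m σ τ a b, l ∈ F → m ∈ F → σ ∈ F → τ ∈ F →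
    Λ.deg l = Λ.deg m → Λ.deg σ = Λ.deg τ →
    Λ.src l = Λ.src m → Λ.src σ = Λ.src τ →
    (a, b) ∈ Λ.minExt m σ → Λ.comp l a ∈ F ∧ Λ.comp τ b ∈ F

/-- `ΠE`, the smallest subset of `Λ` containing `E` and satisfying (†). -/
def piSet (E : Set Λ.Path) : Set Λ.Path := ⋂₀ {F | E ⊆ F ∧ Λ.DaggerClosed F}

/-- For `P ⊆ Λ` and a path `l`, the set `{ν ∈ s(l)Λ : d(ν) > 0 and lν ∈ P}`;
with `P = ΠE` this is the set `T(l)`. -/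
def extInto (P : Set Λ.Path) (l : Λ.Path) : Set Λ.Path :=
  {ν | Λ.src l = Λ.rng ν ∧ Λ.deg ν ≠ 0 ∧ Λ.comp l ν ∈ P}

/-- The projection `Q(t)^{ΠE}_l`. -/
noncomputable def Qproj (t : Λ.Path → A) (E : Set Λ.Path) (l : Λ.Path) : A :=
  t l * star (t l) *
    setProd (Λ.extInto (Λ.piSet E) l)
      (fun ν => t l * star (t l) - t (Λ.comp l ν) * star (t (Λ.comp l ν)))

/-- The matrix unit `Θ(t,E;l,m) = Q(t)^{ΠE}_l t_l t_m^*`. -/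
noncomputable def Theta (t : Λ.Path → A) (E : Set Λ.Path) (l m : Λ.Path) : A :=
  Λ.Qproj t E l * (t l * star (t m))

end KGraph

/-- A degree-preserving functor `x : Ω_{k,m} → Λ` for some `m ∈ (ℕ ∪ {∞})^k`,
recorded by its degree `m` and its values `map p q` on the morphisms `(p,q)` of
`Ω_{k,m}` (normalised to the junk value `map 0 0` on pairs `(p,q)` that are not
morphisms of `Ω_{k,m}`). -/
structure OmegaMor {k : ℕ} (Λ : KGraph k) where
  m : Fin k → ℕ∞
  map : (Fin k → ℕ) → (Fin k → ℕ) → Λ.Path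
  deg_map : ∀ p q : Fin k → ℕ, p ≤ q → (∀ i, (q i : ℕ∞) ≤ m i) →
    Λ.deg (map p q) = q - p
  rng_map : ∀ p q : Fin k → ℕ, p ≤ q → (∀ i, (q i : ℕ∞) ≤ m i) →
    Λ.rng (map p q) = map p p
  src_map : ∀ p q : Fin k → ℕ, p ≤ q → (∀ i, (q i : ℕ∞) ≤ m i) →
    Λ.src (map p q) = map q q
  comp_map : ∀ p q r : Fin k → ℕ, p ≤ q → q ≤ r → (∀ i, (r i : ℕ∞) ≤ m i) →
    Λ.comp (map p q) (map q r) = map p r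
  map_default : ∀ p q : Fin k → ℕ, ¬(p ≤ q ∧ ∀ i, (q i : ℕ∞) ≤ m i) →
    map p q = map 0 0

/-- `x` is a boundary path: there is `n_x ≤ m` such that whenever `n_x ≤ n ≤ m`
and `n_i = m_i`, the vertex `x(n)` receives no edge of degree `e_i`. -/
def OmegaMor.IsBoundary {k : ℕ} {Λ : KGraph k} (x : OmegaMor Λ) : Prop :=
  ∃ nx : Fin k → ℕ, (∀ i, (nx i : ℕ∞) ≤ x.m i) ∧
    ∀ n : Fin k → ℕ, nx ≤ n → (∀ i, (n i : ℕ∞) ≤ x.m i) →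
      ∀ i : Fin k, (n i : ℕ∞) = x.m i →
        ¬∃ e, Λ.rng e = x.map n n ∧ Λ.deg e = Pi.single i 1


namespace KGraph

section Paths

variable {k : ℕ} {Λ : KGraph k}

theorem rng_src (l : Λ.Path) : Λ.rng (Λ.src l) = Λ.src l :=
  Λ.rng_eq_of_deg_zero _ (Λ.deg_src l)

theorem eq_src_of_deg_eq_zero {l a : Λ.Path} (h : Λ.src l = Λ.rng a) (ha : Λ.deg a = 0) :
    a = Λ.src l := by
  rw [h, Λ.rng_eq_of_deg_zero a ha]

theorem comp_of_deg_eq_zero {l a : Λ.Path} (h : Λ.src l = Λ.rng a) (ha : Λ.deg a = 0) :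
    Λ.comp l a = l := by
  rw [eq_src_of_deg_eq_zero h ha, Λ.comp_src_self]

/-- Two factorisations of one path whose initial segments have the same degree agree. -/
theorem comp_inj {l a m b : Λ.Path} (hl : Λ.src l = Λ.rng a) (hm : Λ.src m = Λ.rng b)
    (h : Λ.comp l a = Λ.comp m b) (hd : Λ.deg l = Λ.deg m) : l = m ∧ a = b := by
  have hdeg := congrArg Λ.deg h
  rw [Λ.deg_comp _ _ hl, Λ.deg_comp _ _ hm, hd] at hdeg
  have hab := add_left_cancel hdeg
  have huniq := (Λ.factorisation (Λ.comp m b) _ _ (Λ.deg_comp _ _ hm)).unique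
    (y₁ := (l, a)) (y₂ := (m, b)) ⟨hd, hab, hl, h⟩ ⟨rfl, rfl, hm, rfl⟩
  exact Prod.mk.inj huniq

theorem comp_left_injOn (m : Λ.Path) :
    Set.InjOn (Λ.comp m) {a | Λ.src m = Λ.rng a} :=
  fun _ ha _ hb h => (comp_inj ha hb h rfl).2

/-- Every common extension of two paths factors through a minimal one. -/
theorem exists_minExt_of_comp_eq {l a m b : Λ.Path} (hl : Λ.src l = Λ.rng a)
    (hm : Λ.src m = Λ.rng b) (h : Λ.comp l a = Λ.comp m b) :
    ∃ α β γ, (α, β) ∈ Λ.minExt l m ∧ Λ.src α = Λ.rng γ ∧ Λ.src β = Λ.rng γ ∧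
      Λ.comp α γ = a ∧ Λ.comp β γ = b := by
  have hdeg := congrArg Λ.deg h
  rw [Λ.deg_comp _ _ hl, Λ.deg_comp _ _ hm] at hdeg
  have hdeg' : ∀ i, Λ.deg l i + Λ.deg a i = Λ.deg m i + Λ.deg b i := fun i => congrFun hdeg i
  obtain ⟨⟨α, γ⟩, ⟨hα, -, hαγ, rfl⟩, -⟩ := Λ.factorisation a
    (Λ.deg l ⊔ Λ.deg m - Λ.deg l) (Λ.deg a - (Λ.deg l ⊔ Λ.deg m - Λ.deg l)) (by
      ext i; have := hdeg' i; simp only [Pi.add_apply, Pi.sub_apply, Pi.sup_apply]; omega)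
  obtain ⟨⟨β, δ⟩, ⟨hβ, -, hβδ, rfl⟩, -⟩ := Λ.factorisation b
    (Λ.deg l ⊔ Λ.deg m - Λ.deg m) (Λ.deg b - (Λ.deg l ⊔ Λ.deg m - Λ.deg m)) (by
      ext i; have := hdeg' i; simp only [Pi.add_apply, Pi.sub_apply, Pi.sup_apply]; omega)
  dsimp only at *
  rw [Λ.rng_comp _ _ hαγ] at hl
  rw [Λ.rng_comp _ _ hβδ] at hm
  have hlα : Λ.deg (Λ.comp l α) = Λ.deg l ⊔ Λ.deg m := by
    rw [Λ.deg_comp _ _ hl, hα, add_tsub_cancel_of_le le_sup_left]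
  have hmβ : Λ.deg (Λ.comp m β) = Λ.deg l ⊔ Λ.deg m := by
    rw [Λ.deg_comp _ _ hm, hβ, add_tsub_cancel_of_le le_sup_right]
  rw [← Λ.comp_assoc _ _ _ hl hαγ, ← Λ.comp_assoc _ _ _ hm hβδ] at h
  obtain ⟨h₁, rfl⟩ := comp_inj (by rwa [Λ.src_comp _ _ hl]) (by rwa [Λ.src_comp _ _ hm]) h
    (hlα.trans hmβ.symm)
  exact ⟨α, β, γ, ⟨hl, hm, h₁, hlα⟩, hαγ, hβδ, rfl, rfl⟩

theorem minExt_symm {l m a b : Λ.Path} (h : (a, b) ∈ Λ.minExt l m) : (b, a) ∈ Λ.minExt m l := by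
  obtain ⟨h₁, h₂, h₃, h₄⟩ := h
  exact ⟨h₂, h₁, h₃.symm, by rw [← h₃, h₄, sup_comm]⟩

/-- By symmetry of minimal common extensions, half of condition (†) suffices. -/
theorem daggerClosed_of_left {F : Set Λ.Path}
    (h : ∀ l m σ a b, l ∈ F → m ∈ F → σ ∈ F → Λ.deg l = Λ.deg m → Λ.src l = Λ.src m →
      (a, b) ∈ Λ.minExt m σ → Λ.comp l a ∈ F) : Λ.DaggerClosed F :=
  fun l m σ τ a b hl hm hσ hτ hd hd' hs hs' hab =>
    ⟨h l m σ a b hl hm hσ hd hs hab,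
      h τ σ m b a hτ hσ hm hd'.symm hs'.symm (minExt_symm hab)⟩

theorem subset_piSet (E : Set Λ.Path) : E ⊆ Λ.piSet E :=
  Set.subset_sInter fun _ hF => hF.1

theorem piSet_subset {E F : Set Λ.Path} (hE : E ⊆ F) (hF : Λ.DaggerClosed F) :
    Λ.piSet E ⊆ F :=
  Set.sInter_subset_of_mem ⟨hE, hF⟩

theorem daggerClosed_piSet (E : Set Λ.Path) : Λ.DaggerClosed (Λ.piSet E) := by
  intro l m σ τ a b hl hm hσ hτ hd hd' hs hs' hab
  have key := fun F (hF : F ∈ {F | E ⊆ F ∧ Λ.DaggerClosed F}) => hF.2 l m σ τ a b (hl F hF) (hm F hF) (hσ F hF)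
    (hτ F hF) hd hd' hs hs' hab
  exact ⟨fun F hF => (key F hF).1, fun F hF => (key F hF).2⟩

theorem comp_mem_piSet_of_minExt {E : Set Λ.Path} {l m a b : Λ.Path} (hl : l ∈ Λ.piSet E)
    (hm : m ∈ Λ.piSet E) (hab : (a, b) ∈ Λ.minExt l m) : Λ.comp l a ∈ Λ.piSet E :=
  (daggerClosed_piSet E l l m m a b hl hl hm hm rfl rfl rfl rfl hab).1

/-- The degree of a swapped minimal common extension. -/
theorem deg_comp_of_minExt {l m σ a b : Λ.Path} (hd : Λ.deg l = Λ.deg m)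
    (hs : Λ.src l = Λ.src m) (hab : (a, b) ∈ Λ.minExt m σ) :
    Λ.deg (Λ.comp l a) = Λ.deg m ⊔ Λ.deg σ := by
  rw [Λ.deg_comp _ _ (hs.trans hab.1), hd, ← Λ.deg_comp _ _ hab.1, hab.2.2.2]

theorem deg_le_of_mem_piSet {E : Set Λ.Path} {N : Fin k → ℕ} (hN : ∀ l ∈ E, Λ.deg l ≤ N)
    {l : Λ.Path} (hl : l ∈ Λ.piSet E) : Λ.deg l ≤ N := by
  refine piSet_subset (F := {l | Λ.deg l ≤ N}) hN (daggerClosed_of_left ?_) hl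
  intro l m σ a b _ hm hσ hd hs hab
  simpa only [Set.mem_ofPred_eq, deg_comp_of_minExt hd hs hab] using sup_le hm hσ

/-- The set of final segments of a path. -/
def tails (Λ : KGraph k) (l : Λ.Path) : Set Λ.Path :=
  {a | ∃ m, Λ.src m = Λ.rng a ∧ Λ.comp m a = l}

theorem finite_tails (l : Λ.Path) : (Λ.tails l).Finite := by
  refine Set.Finite.of_finite_image (f := Λ.deg) ((Set.finite_Iic (Λ.deg l)).subset ?_) ?_
  · rintro _ ⟨a, ⟨m, hm, rfl⟩, rfl⟩
    rw [Set.mem_Iic, Λ.deg_comp _ _ hm]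
    exact le_add_self
  · rintro a ⟨m, hm, hma⟩ b ⟨m', hm', hmb⟩ hab
    have h := hma.trans hmb.symm
    have hd := congrArg Λ.deg h
    rw [Λ.deg_comp _ _ hm, Λ.deg_comp _ _ hm', hab] at hd
    exact (comp_inj hm hm' h (add_right_cancel hd)).2

theorem tails_trans {l a b c : Λ.Path} (h : Λ.src b = Λ.rng c) (hbc : Λ.comp b c = a)
    (ha : a ∈ Λ.tails l) : c ∈ Λ.tails l := by
  obtain ⟨m, hm, rfl⟩ := ha
  subst hbc
  rw [Λ.rng_comp _ _ h] at hm
  exact ⟨Λ.comp m b, by rwa [Λ.src_comp _ _ hm], Λ.comp_assoc _ _ _ hm h⟩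

/-- If `ΠE` has finitely many elements of each degree strictly below `n`, then it has finitely
many elements of degree `n`: each of them is in `E`, is a minimal common extension of two elements
of lower degree, or arises from such a path by replacing an initial segment by an element
of lower degree. -/
theorem finite_piSet_deg_eq (hΛ : Λ.FinitelyAligned) {E : Set Λ.Path} (hE : E.Finite)
    (n : Fin k → ℕ) (ih : ∀ p < n, {l ∈ Λ.piSet E | Λ.deg l = p}.Finite) :
    {l ∈ Λ.piSet E | Λ.deg l = n}.Finite := by
  set L : Set Λ.Path := {l ∈ Λ.piSet E | Λ.deg l < n}
  have hLfin : L.Finite := by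
    refine (Set.Finite.biUnion (Set.finite_Iio n) ih).subset fun l hl => ?_
    exact Set.mem_biUnion (show Λ.deg l ∈ Set.Iio n from hl.2) ⟨hl.1, rfl⟩
  set G : Set Λ.Path := E ∪ ⋃ m ∈ L, ⋃ σ ∈ L, (fun p => Λ.comp m p.1) '' Λ.minExt m σ
  have hGfin : G.Finite :=
    hE.union (hLfin.biUnion fun m _ => hLfin.biUnion fun σ _ => (hΛ m σ).image _)
  set K : Set Λ.Path := G ∪ {x | ∃ l ∈ L, ∃ σ ∈ G, ∃ a ∈ Λ.tails σ,
    Λ.src l = Λ.rng a ∧ Λ.comp l a = x}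
  have hKfin : K.Finite := by
    refine hGfin.union ((hLfin.image2 Λ.comp
      (hGfin.biUnion fun σ _ => finite_tails σ)).subset ?_)
    rintro _ ⟨l, hl, σ, hσ, a, ha, -, rfl⟩
    exact Set.mem_image2_of_mem hl (Set.mem_biUnion hσ ha)
  have hmemG : ∀ {m σ a b}, m ∈ L → σ ∈ L → (a, b) ∈ Λ.minExt m σ → Λ.comp m a ∈ G :=
    fun hm hσ hab => Or.inr (Set.mem_biUnion hm (Set.mem_biUnion hσ ⟨_, hab, rfl⟩))
  have hmemK : ∀ {l a σ}, l ∈ L → σ ∈ G → a ∈ Λ.tails σ → Λ.src l = Λ.rng a →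
      Λ.comp l a ∈ K :=
    fun hl hσ ha hla => Or.inr ⟨_, hl, _, hσ, _, ha, hla, rfl⟩
  suffices h : Λ.piSet E ⊆ {l ∈ Λ.piSet E | Λ.deg l = n → l ∈ K} from
    hKfin.subset fun l hl => (h hl.1).2 hl.2
  refine piSet_subset (fun l hl => ⟨subset_piSet E hl, fun _ => Or.inl (Or.inl hl)⟩)
    (daggerClosed_of_left ?_)
  rintro l m σ a b ⟨hlP, hlK⟩ ⟨hmP, -⟩ ⟨hσP, hσK⟩ hd hs hab
  refine ⟨(daggerClosed_piSet E l m σ σ a b hlP hmP hσP hσP hd rfl hs rfl hab).1, fun hn => ?_⟩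
  rw [deg_comp_of_minExt hd hs hab] at hn
  obtain ⟨hma, hσb, hmaσb, hdeg⟩ := hab
  dsimp only at hma hσb hmaσb hdeg
  have hla : Λ.src l = Λ.rng a := hs.trans hma
  rcases (hn ▸ le_sup_left : Λ.deg m ≤ n).eq_or_lt with hmn | hmn
  · have ha : Λ.deg a = 0 := by
      rw [Λ.deg_comp _ _ hma, hn, hmn] at hdeg
      simpa using hdeg
    rw [comp_of_deg_eq_zero hla ha]
    exact hlK (hd.trans hmn)
  have hmL : m ∈ L := ⟨hmP, hmn⟩
  have hlL : l ∈ L := ⟨hlP, hd ▸ hmn⟩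
  have hmaK : Λ.comp m a ∈ G → Λ.comp l a ∈ K := fun h => hmemK hlL h ⟨m, hma, rfl⟩ hla
  rcases (hn ▸ le_sup_right : Λ.deg σ ≤ n).eq_or_lt with hσn | hσn
  swap
  · exact hmaK (hmemG hmL ⟨hσP, hσn⟩ ⟨hma, hσb, hmaσb, hdeg⟩)
  have hb : Λ.deg b = 0 := by
    rw [hmaσb, Λ.deg_comp _ _ hσb, hn, hσn] at hdeg
    simpa using hdeg
  rw [comp_of_deg_eq_zero hσb hb] at hmaσb
  rcases hσK hσn with hσG | ⟨l₀, hl₀, σ₀, hσ₀, a₀, ha₀, hcomp, hσ⟩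
  · exact hmaK (hmaσb ▸ hσG)
  obtain ⟨α, β, γ, hαβ, hαγ, hβγ, hα, hβ⟩ :=
    exists_minExt_of_comp_eq hcomp hma (hσ.trans hmaσb.symm)
  have hβα := minExt_symm hαβ
  have hlβ : Λ.src l = Λ.rng β := hs.trans hβα.1
  have hdβ := deg_comp_of_minExt hd hs hβα
  have hle : Λ.deg m ⊔ Λ.deg l₀ ≤ n := sup_le hmn.le hl₀.2.le
  rcases hle.eq_or_lt with hq | hq
  · have hγ : Λ.deg γ = 0 := by
      have h₁ := hdeg
      rw [hn, ← hβ, ← Λ.comp_assoc _ _ _ hβα.1 hβγ,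
        Λ.deg_comp _ _ (by rwa [Λ.src_comp _ _ hβα.1]), hβα.2.2.2, hq] at h₁
      simpa using h₁
    rw [comp_of_deg_eq_zero hβγ hγ] at hβ
    exact hmaK (hβ ▸ hmemG hmL hl₀ hβα)
  · rw [← hβ, ← Λ.comp_assoc _ _ _ hlβ hβγ]
    refine hmemK ⟨?_, hdβ ▸ hq⟩ hσ₀ (tails_trans hαγ hα ha₀)
      (by rwa [Λ.src_comp _ _ hlβ])
    exact (daggerClosed_piSet E l m l₀ l₀ β α hlP hmP hl₀.1 hl₀.1 hd rfl hs rfl hβα).1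

theorem finite_piSet (hΛ : Λ.FinitelyAligned) {E : Set Λ.Path} (hE : E.Finite) :
    (Λ.piSet E).Finite := by
  have hdeg : ∀ n : Fin k → ℕ, {l ∈ Λ.piSet E | Λ.deg l = n}.Finite := fun n =>
    WellFoundedLT.induction n fun n ih => finite_piSet_deg_eq hΛ hE n ih
  obtain ⟨N, hN⟩ := (hE.image Λ.deg).bddAbove
  refine ((Set.finite_Iic N).biUnion fun n _ => hdeg n).subset fun l hl => ?_
  exact Set.mem_biUnion (show Λ.deg l ∈ Set.Iic N from
    deg_le_of_mem_piSet (fun l hl => hN (Set.mem_image_of_mem _ hl)) hl) ⟨hl, rfl⟩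

end Paths

end KGraph

section Products

universe u

theorem setSum_eq_sum {ι A : Type*} [AddCommMonoid A] {S : Set ι} (h : S.Finite) (f : ι → A) :
    setSum S f = ∑ i ∈ h.toFinset, f i :=
  dif_pos h

theorem map_setProd {ι R A : Type*} [CommMonoid R] [Monoid A] (φ : R →* A) {S : Set ι}
    (h : S.Finite) (f : ι → R) :
    setProd S (fun i => φ (f i)) = φ (∏ i ∈ h.toFinset, f i) := by
  rw [setProd, dif_pos h, ← Finset.prod_map_toList, map_list_prod, List.map_map]
  rfl

theorem mul_prod_one_sub_eq_self {ι R : Type*} [CommRing R] (s : Finset ι) (q : ι → R) {x : R}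
    (h : ∀ i ∈ s, x * q i = 0) : x * ∏ i ∈ s, (1 - q i) = x := by
  classical
  induction s using Finset.induction_on with
  | empty => simp
  | insert i s hi ih =>
    rw [Finset.prod_insert hi, ← mul_assoc, mul_sub, h i (Finset.mem_insert_self i s), mul_one,
      sub_zero, ih fun j hj => h j (Finset.mem_insert_of_mem hj)]

theorem mul_prod_one_sub_eq_zero {ι R : Type*} [CommRing R] {s : Finset ι} {q : ι → R} {i : ι}
    (hi : i ∈ s) (hq : q i * q i = q i) : q i * ∏ j ∈ s, (1 - q j) = 0 := by
  classical
  rw [← Finset.mul_prod_erase s _ hi, ← mul_assoc, mul_sub, hq, mul_one, sub_self, zero_mul]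

theorem mul_prod_sub_eq {ι R : Type*} [CommRing R] (s : Finset ι) (q : ι → R) {x : R}
    (hx : x * x = x) : x * ∏ i ∈ s, (x - x * q i) = x * ∏ i ∈ s, (1 - q i) := by
  classical
  induction s using Finset.induction_on with
  | empty => simp
  | insert i s hi ih =>
    rw [Finset.prod_insert hi, Finset.prod_insert hi, mul_left_comm, ih]
    linear_combination ((1 - q i) * ∏ i ∈ s, (1 - q i)) * hx

/-- The complement of a product of complements decomposes as the sum of the elements
`q i * ∏ j ∈ T i, (1 - q j)`, provided `q i * q j` is supported on `T i` whenever
`i ≠ j` and the rank of `j` is at least that of `i`. -/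
theorem one_sub_prod_one_sub_eq_sum {ι R : Type*} [CommRing R] [DecidableEq ι] (q : ι → R)
    (rank : ι → ℕ) (T : ι → Finset ι) (S : Finset ι) (hT : ∀ i ∈ S, T i ⊆ S)
    (hrank : ∀ i ∈ S, ∀ j ∈ T i, rank i < rank j)
    (hq : ∀ i ∈ S, ∀ j ∈ S, i ≠ j → rank i ≤ rank j →
      q i * q j * ∏ l ∈ T i, (1 - q l) = 0) :
    1 - ∏ i ∈ S, (1 - q i) = ∑ i ∈ S, q i * ∏ j ∈ T i, (1 - q j) := by
  induction S using Finset.induction_on_min_value rank with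
  | empty => simp
  | insert a s ha hmin ih =>
    have hTs : ∀ i ∈ insert a s, T i ⊆ s := by
      intro i hi j hj
      refine (Finset.mem_insert.1 (hT i hi hj)).resolve_left ?_
      rintro rfl
      have h := hrank i hi _ hj
      rcases Finset.mem_insert.1 hi with rfl | hi
      · exact h.false
      · exact (h.trans_le (hmin i hi)).false
    have hs : ∀ {i}, i ∈ s → i ∈ insert a s := Finset.mem_insert_of_mem
    rw [Finset.prod_insert ha, Finset.sum_insert ha, ← ih (fun i hi => hTs i (hs hi))
      (fun i hi => hrank i (hs hi)) fun i hi j hj => hq i (hs hi) j (hs hj)]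
    have haS : a ∈ insert a s := Finset.mem_insert_self a s
    have key : q a * ∏ i ∈ s, (1 - q i) = q a * ∏ j ∈ T a, (1 - q j) := by
      rw [← Finset.prod_sdiff (hTs a haS), mul_comm (∏ i ∈ s \ T a, (1 - q i)), ← mul_assoc]
      refine mul_prod_one_sub_eq_self _ _ fun j hj => ?_
      have hj := (Finset.mem_sdiff.1 hj).1
      rw [mul_right_comm]
      exact hq a haS j (hs hj) (fun h => ha (h ▸ hj)) (hmin j hj)
    rw [← key]
    ring

open scoped IsMulCommutative in
/-- A commuting family in a ring lifts along an injective homomorphism from a commutative ring. -/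
theorem exists_commRing_lift {ι : Type*} {A : Type u} [Ring A] (q : ι → A)
    (h : ∀ i j, q i * q j = q j * q i) :
    ∃ (R : Type u) (_ : CommRing R) (φ : R →+* A) (q' : ι → R),
      Function.Injective φ ∧ ∀ i, φ (q' i) = q i := by
  have : IsMulCommutative (Subring.closure (Set.range q)) :=
    Subring.isMulCommutative_closure (by rintro _ ⟨i, rfl⟩ _ ⟨j, rfl⟩; exact h i j)
  exact ⟨Subring.closure (Set.range q), inferInstance,
    (Subring.closure (Set.range q)).subtype,
    fun i => ⟨q i, Subring.subset_closure ⟨i, rfl⟩⟩, Subtype.val_injective, fun _ => rfl⟩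

end Products

namespace KGraph

section Families

variable {k : ℕ} {Λ : KGraph k} {A : Type*} [Ring A] [StarRing A] {t : Λ.Path → A}

theorem IsCK13.range_mul_range (ht : Λ.IsCK13 t) (hΛ : Λ.FinitelyAligned) (l m : Λ.Path) :
    t l * star (t l) * (t m * star (t m)) =
      ∑ p ∈ (hΛ l m).toFinset, t (Λ.comp l p.1) * star (t (Λ.comp l p.1)) := by
  rw [mul_assoc, ← mul_assoc (star (t l)), ht.ck3, setSum_eq_sum (hΛ l m), Finset.sum_mul,
    Finset.mul_sum]
  refine Finset.sum_congr rfl fun p hp => ?_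
  obtain ⟨h₁, h₂, h₃, -⟩ := (hΛ l m).mem_toFinset.1 hp
  nth_rw 2 [h₃]
  rw [← ht.comp_mul _ _ h₁, ← ht.comp_mul _ _ h₂, star_mul]
  simp only [mul_assoc]

theorem IsCK13.range_comm (ht : Λ.IsCK13 t) (hΛ : Λ.FinitelyAligned) (l m : Λ.Path) :
    t l * star (t l) * (t m * star (t m)) = t m * star (t m) * (t l * star (t l)) := by
  have h := congrArg star (ht.range_mul_range hΛ l m)
  simp only [star_mul, star_star, star_sum] at h
  rw [h, ht.range_mul_range hΛ l m]

theorem IsCK13.range_mul_self (ht : Λ.IsCK13 t) (l : Λ.Path) :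
    t l * star (t l) * (t l * star (t l)) = t l * star (t l) := by
  rw [← mul_assoc, ht.partialIsometry]

theorem IsCK13.range_mul_range_comp (ht : Λ.IsCK13 t) {l a : Λ.Path} (h : Λ.src l = Λ.rng a) :
    t l * star (t l) * (t (Λ.comp l a) * star (t (Λ.comp l a))) =
      t (Λ.comp l a) * star (t (Λ.comp l a)) := by
  rw [← ht.comp_mul _ _ h, ← mul_assoc, ← mul_assoc, ht.partialIsometry]

/-- The range projection of `t m` is the sum of the projections `Q(t)^{ΠE}` over the elements
of `ΠE` extending `m`. Relation (CK4) is not needed. -/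
theorem IsCK13.range_eq_setSum_Qproj (ht : Λ.IsCK13 t) (hΛ : Λ.FinitelyAligned)
    {E : Set Λ.Path} (hE : E.Finite) {m : Λ.Path} (hm : m ∈ Λ.piSet E) :
    t m * star (t m) =
      setSum {ν : Λ.Path | Λ.src m = Λ.rng ν ∧ Λ.comp m ν ∈ Λ.piSet E}
        (fun ν => Λ.Qproj t E (Λ.comp m ν)) := by
  classical
  have hfin := finite_piSet hΛ hE
  obtain ⟨R, _, φ, q, hφ, hq⟩ := exists_commRing_lift (fun l => t l * star (t l))
    (ht.range_comm hΛ)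
  have hidem : ∀ l, q l * q l = q l := fun l => hφ (by
    rw [map_mul, hq]; exact ht.range_mul_self l)
  have hext : ∀ {l a}, Λ.src l = Λ.rng a → q l * q (Λ.comp l a) = q (Λ.comp l a) :=
    fun h => hφ (by rw [map_mul, hq, hq]; exact ht.range_mul_range_comp h)
  have hmul : ∀ l m, q l * q m = ∑ p ∈ (hΛ l m).toFinset, q (Λ.comp l p.1) := fun l m => hφ (by
    simp only [map_mul, map_sum, hq]; exact ht.range_mul_range hΛ l m)
  have hextfin : ∀ l, (Λ.extInto (Λ.piSet E) l).Finite := fun l =>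
    Set.Finite.of_finite_image (hfin.subset (by rintro _ ⟨a, ha, rfl⟩; exact ha.2.2))
      ((comp_left_injOn l).mono fun a ha => ha.1)
  have hsumfin : {ν : Λ.Path | Λ.src m = Λ.rng ν ∧ Λ.comp m ν ∈ Λ.piSet E}.Finite :=
    Set.Finite.of_finite_image (hfin.subset (by rintro _ ⟨a, ha, rfl⟩; exact ha.2))
      ((comp_left_injOn m).mono fun a ha => ha.1)
  set T : Λ.Path → Finset Λ.Path := fun l => (hextfin l).toFinset.image (Λ.comp l) with hT
  set S : Finset Λ.Path := hsumfin.toFinset.image (Λ.comp m) with hS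
  have hmemT : ∀ {l x}, x ∈ T l ↔ ∃ a, a ∈ Λ.extInto (Λ.piSet E) l ∧ Λ.comp l a = x := by
    simp [hT]
  have hmemS : ∀ {x}, x ∈ S ↔
      ∃ a, (Λ.src m = Λ.rng a ∧ Λ.comp m a ∈ Λ.piSet E) ∧ Λ.comp m a = x := by
    simp [hS]
  have hQ : ∀ l, Λ.Qproj t E l = φ (q l * ∏ x ∈ T l, (1 - q x)) := by
    intro l
    rw [hT, Finset.prod_image ((comp_left_injOn l).mono fun a ha =>
      ((hextfin l).mem_toFinset.1 ha).1), ← mul_prod_sub_eq _ _ (hidem l), map_mul, hq,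
      Finset.prod_congr rfl (g := fun a => q l - q (Λ.comp l a)) (fun a ha => by
        rw [hext ((hextfin l).mem_toFinset.1 ha).1])]
    have h := map_setProd (φ : R →* A) (hextfin l) fun a => q l - q (Λ.comp l a)
    simp only [MonoidHom.coe_coe, map_sub, hq] at h
    rw [← h]
    rfl
  have hdecomp := one_sub_prod_one_sub_eq_sum q (fun l => ∑ i, Λ.deg l i) T S ?_ ?_ ?_
  · have hmS : m ∈ S := hmemS.2
      ⟨Λ.src m, ⟨(rng_src m).symm, by rwa [Λ.comp_src_self]⟩, Λ.comp_src_self m⟩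
    have hprod : ∏ x ∈ S, (1 - q x) = 1 - q m := by
      rw [← Finset.mul_prod_erase S _ hmS]
      refine mul_prod_one_sub_eq_self _ _ fun x hx => ?_
      obtain ⟨a, ha, rfl⟩ := hmemS.1 (Finset.mem_of_mem_erase hx)
      rw [sub_mul, one_mul, hext ha.1, sub_self]
    rw [hprod, sub_sub_cancel] at hdecomp
    rw [setSum_eq_sum hsumfin, ← hq, hdecomp, map_sum, hS, Finset.sum_image
      ((comp_left_injOn m).mono fun a ha => (hsumfin.mem_toFinset.1 ha).1)]
    exact Finset.sum_congr rfl fun a _ => (hQ _).symm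
  · intro l hl x hx
    obtain ⟨a, ⟨ha, -⟩, rfl⟩ := hmemS.1 hl
    obtain ⟨b, ⟨hb, -, hbP⟩, rfl⟩ := hmemT.1 hx
    rw [Λ.src_comp _ _ ha] at hb
    rw [Λ.comp_assoc _ _ _ ha hb] at hbP ⊢
    exact hmemS.2 ⟨_, ⟨by rwa [Λ.rng_comp _ _ hb], hbP⟩, rfl⟩
  · intro l _ x hx
    obtain ⟨b, ⟨hb, hb0, -⟩, rfl⟩ := hmemT.1 hx
    simp only [Λ.deg_comp _ _ hb, Pi.add_apply, Finset.sum_add_distrib]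
    refine Nat.lt_add_of_pos_right (Nat.pos_of_ne_zero fun h => hb0 ?_)
    ext i
    exact (Finset.sum_eq_zero_iff.1 h) i (Finset.mem_univ i)
  · intro l hl x hx hne hrank
    have hlP : l ∈ Λ.piSet E := by obtain ⟨a, ha, rfl⟩ := hmemS.1 hl; exact ha.2
    have hxP : x ∈ Λ.piSet E := by obtain ⟨a, ha, rfl⟩ := hmemS.1 hx; exact ha.2
    rw [hmul, Finset.sum_mul]
    refine Finset.sum_eq_zero fun ⟨a, b⟩ hab => ?_
    rw [Set.Finite.mem_toFinset] at hab
    refine mul_prod_one_sub_eq_zero (hmemT.2 ⟨a, ⟨hab.1, fun ha => hne ?_,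
      comp_mem_piSet_of_minExt hlP hxP hab⟩, rfl⟩) (hidem _)
    obtain ⟨hla, hxb, hcomp, hdeg⟩ := hab
    dsimp only at hla hxb hcomp hdeg
    rw [comp_of_deg_eq_zero hla ha] at hcomp hdeg
    have hle : ∀ i, Λ.deg x i ≤ Λ.deg l i := fun i => (hdeg ▸ le_sup_right : Λ.deg x ≤ Λ.deg l) i
    have heq : Λ.deg l = Λ.deg x := by
      ext i
      exact (((Finset.sum_eq_sum_iff_of_le fun i _ => hle i).1
        (le_antisymm (Finset.sum_le_sum fun i _ => hle i) hrank)) i (Finset.mem_univ i)).symm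
    rw [hcomp, Λ.deg_comp _ _ hxb] at heq
    rw [hcomp, comp_of_deg_eq_zero hxb (by simpa using heq)]

end Families

end KGraph

/-- for `m ∈ ΠE`, `t_m t_m^* = Σ_{ν : mν ∈ ΠE} Q(t)^{ΠE}_{mν}`. -/
theorem stmt8 {k : ℕ} (Λ : KGraph k) (hΛ : Λ.FinitelyAligned)
    (E : Set Λ.Path) (hE : E.Finite) {A : Type*} [CStarAlgebra A]
    (t : Λ.Path → A) (ht : Λ.IsCKFamily t)
    (m : Λ.Path) (hm : m ∈ Λ.piSet E) :
    t m * star (t m) =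
      setSum {ν : Λ.Path | Λ.src m = Λ.rng ν ∧ Λ.comp m ν ∈ Λ.piSet E}
        (fun ν => Λ.Qproj t E (Λ.comp m ν)) := by
  exact ht.toIsCK13.range_eq_setSum_Qproj hΛ hE hm
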